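/- There exists a constant C > 0 such that for every s ∈ ℕ⁺ there exists M = M(s) > 0 with the following property: whenever d^1,…,d^s ∈ ℤ^d \ {0} satisfy |d^{k+1}| > M |d^k| for k = 1,…,s−1, then ∫_{[0,1]^d} | ∑_{j=1}^s (−1)^j cos(2π⟨d^j,ξ⟩) ∏_{1≤k<j} (1 + cos(2π⟨d^k,ξ⟩)) | dξ ≥ C s. -/

import Mathlib

open MeasureTheory Filter Real Topology

/-- Euclidean norm of an integer vector in `ℤ^d`. -/
noncomputable def intNorm {d : ℕ} (n : Fin d → ℤ) : ℝ :=
  Real.sqrt (∑ i, ((n i : ℝ)) ^ 2)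

/-- The alternating Riesz sum `∑ⱼ (-1)ʲ yⱼ ∏_{k<j} (1 + yₖ)`. -/
noncomputable def altRieszSum (n : ℕ) (y : Fin n → ℝ) : ℝ :=
  ∑ j : Fin n, (-1 : ℝ) ^ (j : ℕ) * y j * ∏ k ∈ Finset.Iio j, (1 + y k)

lemma altRieszSum_zero (y : Fin 0 → ℝ) : altRieszSum 0 y = 0 := by
  simp [altRieszSum]

lemma altRieszSum_succ {n : ℕ} (y : Fin (n + 1) → ℝ) :
    altRieszSum (n + 1) y = y 0 - (1 + y 0) * altRieszSum n (fun i ↦ y i.succ) := by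
  have hprod (i : Fin n) : ∏ k ∈ Finset.Iio i.succ, (1 + y k) =
      (1 + y 0) * ∏ k ∈ Finset.Iio i, (1 + y k.succ) := by
    have hset : Finset.Iio i.succ = insert 0 ((Finset.Iio i).map (Fin.succEmb n)) := by
      ext k
      refine Fin.cases ?_ (fun k ↦ ?_) k <;> simp
    rw [hset, Finset.prod_insert (by simp), Finset.prod_map]
    rfl
  have hzero : Finset.Iio (0 : Fin (n + 1)) = ∅ := by
    ext k
    simp
  rw [altRieszSum, Fin.sum_univ_succ, altRieszSum, Finset.mul_sum, hzero, sub_eq_add_neg,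
    ← Finset.sum_neg_distrib]
  congr 1
  · simp
  · refine Finset.sum_congr rfl fun i _ ↦ ?_
    rw [hprod, Fin.val_succ, pow_succ]
    ring

lemma continuous_altRieszSum (n : ℕ) : Continuous (altRieszSum n) := by
  unfold altRieszSum
  fun_prop

lemma sqrt_le_of_mem_Icc {c : ℝ} (h₁ : -1 ≤ c) (h₂ : c ≤ 1) :
    √(1 + c) ≤ 1 + c / 2 - c ^ 2 / 12 := by
  have : 0 ≤ 1 + c / 2 - c ^ 2 / 12 := by nlinarith
  rw [Real.sqrt_le_left this]
  have h : 0 ≤ c ^ 2 * (1 / 12 - c / 12 + c ^ 2 / 144) := by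
    refine mul_nonneg (sq_nonneg _) ?_
    nlinarith [sq_nonneg c]
  nlinarith

section RandomRecursion

variable {X : Type*} [TopologicalSpace X] [CompactSpace X] [MeasurableSpace X] [BorelSpace X]
  {μ : Measure X} [IsProbabilityMeasure μ] {c : X → ℝ}

lemma integrable_of_continuous {Y E : Type*} [TopologicalSpace Y] [CompactSpace Y]
    [SecondCountableTopology Y] [MeasurableSpace Y] [BorelSpace Y] {ν : Measure Y}
    [IsFiniteMeasure ν] [NormedAddCommGroup E] {f : Y → E} (hf : Continuous f) : Integrable f ν :=
  hf.integrable_of_hasCompactSupport (HasCompactSupport.of_compactSpace f)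

/-- One step of the averaged random recursion `t ↦ c - (1 + c) t`. -/
noncomputable def stepAvg (μ : Measure X) (c : X → ℝ) (φ : ℝ → ℝ) (t : ℝ) : ℝ :=
  ∫ x, φ (c x - (1 + c x) * t) ∂μ

lemma continuous_stepAvg (hc : Continuous c) {φ : ℝ → ℝ} (hφ : Continuous φ) :
    Continuous (stepAvg μ c φ) := by
  have := continuous_parametric_integral_of_continuous (μ := μ)
    (f := fun t x ↦ φ (c x - (1 + c x) * t)) (by unfold Function.uncurry; fun_prop) isCompact_univ
  unfold stepAvg
  simpa only [Measure.restrict_univ] using this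

variable [SecondCountableTopology X]

lemma integral_altRieszSum_succ (hc : Continuous c) {φ : ℝ → ℝ} (hφ : Continuous φ) (n : ℕ) :
    ∫ y, φ (altRieszSum (n + 1) (c ∘ y)) ∂(Measure.pi fun _ ↦ μ) =
      ∫ y, stepAvg μ c φ (altRieszSum n (c ∘ y)) ∂(Measure.pi fun _ ↦ μ) := by
  have hmp := (measurePreserving_piFinSuccAbove (fun _ : Fin (n + 1) ↦ μ) 0)
  have hcont := continuous_altRieszSum n
  rw [← hmp.symm.integral_comp', ← integral_prod_swap, integral_prod]
  · simp [altRieszSum_succ, MeasurableEquiv.piFinSuccAbove, Fin.insertNthEquiv, stepAvg]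
    rfl
  · simp [altRieszSum_succ, MeasurableEquiv.piFinSuccAbove, Fin.insertNthEquiv]
    refine integrable_of_continuous ?_
    fun_prop

lemma stepAvg_sqrt_abs_le (hc : Continuous c) (hlb : ∀ x, -1 ≤ c x) (hub : ∀ x, c x ≤ 1)
    (hmean : ∫ x, c x ∂μ = 0) (hvar : ∫ x, c x ^ 2 ∂μ = 1 / 2) (t : ℝ) :
    stepAvg μ c (fun u ↦ √|u|) t ≤ 1 + 23 / 24 * √|t| := by
  have hpt (x : X) : √|c x - (1 + c x) * t| ≤ 1 + (1 + c x / 2 - c x ^ 2 / 12) * √|t| := by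
    have h₁ : |c x - (1 + c x) * t| ≤ 1 + (1 + c x) * |t| := by
      refine (abs_sub _ _).trans ?_
      rw [abs_mul, abs_of_nonneg (by linarith [hlb x] : 0 ≤ 1 + c x)]
      gcongr
      exact abs_le.2 ⟨hlb x, hub x⟩
    calc √|c x - (1 + c x) * t| ≤ √(1 + (1 + c x) * |t|) := Real.sqrt_le_sqrt h₁
      _ ≤ 1 + √((1 + c x) * |t|) := by
        have h₂ : 0 ≤ (1 + c x) * |t| := mul_nonneg (by linarith [hlb x]) (abs_nonneg t)
        rw [Real.sqrt_le_left (by positivity)]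
        nlinarith [Real.sq_sqrt h₂, Real.sqrt_nonneg ((1 + c x) * |t|)]
      _ = 1 + √(1 + c x) * √|t| := by rw [Real.sqrt_mul (by linarith [hlb x])]
      _ ≤ _ := by
        gcongr
        exact sqrt_le_of_mem_Icc (hlb x) (hub x)
  have hint {f : X → ℝ} (hf : Continuous f) : Integrable f μ := integrable_of_continuous hf
  calc stepAvg μ c (fun u ↦ √|u|) t
      ≤ ∫ x, (1 + (1 + c x / 2 - c x ^ 2 / 12) * √|t|) ∂μ :=
        integral_mono (hint (by fun_prop)) (hint (by fun_prop)) hpt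
    _ = 1 + 23 / 24 * √|t| := by
        rw [integral_add (hint (by fun_prop)) (hint (by fun_prop)), integral_mul_const,
          integral_sub (hint (by fun_prop)) (hint (by fun_prop)),
          integral_add (hint (by fun_prop)) (hint (by fun_prop)), integral_div, integral_div,
          hmean, hvar]
        simp
        norm_num

lemma integral_sqrt_abs_altRieszSum_le (hc : Continuous c) (hlb : ∀ x, -1 ≤ c x)
    (hub : ∀ x, c x ≤ 1) (hmean : ∫ x, c x ∂μ = 0) (hvar : ∫ x, c x ^ 2 ∂μ = 1 / 2) (n : ℕ) :
    ∫ y, √|altRieszSum n (c ∘ y)| ∂(Measure.pi fun _ ↦ μ) ≤ 24 := by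
  induction n with
  | zero => simp [altRieszSum_zero]
  | succ n ih =>
    have hcont := continuous_altRieszSum n
    have hstep : Continuous (stepAvg μ c fun u ↦ √|u|) := continuous_stepAvg hc (by fun_prop)
    rw [integral_altRieszSum_succ hc (φ := fun u ↦ √|u|) (by fun_prop)]
    calc _ ≤ ∫ y, (1 + 23 / 24 * √|altRieszSum n (c ∘ y)|) ∂(Measure.pi fun _ ↦ μ) :=
          integral_mono (integrable_of_continuous (by fun_prop))
            (integrable_of_continuous (by fun_prop))
            fun y ↦ stepAvg_sqrt_abs_le hc hlb hub hmean hvar _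
      _ = 1 + 23 / 24 * ∫ y, √|altRieszSum n (c ∘ y)| ∂(Measure.pi fun _ ↦ μ) := by
          rw [integral_add (integrable_of_continuous (by fun_prop))
            (integrable_of_continuous (by fun_prop)), integral_const_mul]
          simp
      _ ≤ 24 := by linarith

lemma integral_sub_one_add_mul (hc : Continuous c) (hmean : ∫ x, c x ∂μ = 0) (t : ℝ) :
    ∫ x, (c x - (1 + c x) * t) ∂μ = -t := by
  have hint {f : X → ℝ} (hf : Continuous f) : Integrable f μ := integrable_of_continuous hf
  rw [integral_sub (hint hc) (hint (by fun_prop)), integral_mul_const,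
    integral_add (hint (by fun_prop)) (hint hc), hmean]
  simp

lemma abs_le_stepAvg_abs (hc : Continuous c) (hmean : ∫ x, c x ∂μ = 0) (t : ℝ) :
    |t| ≤ stepAvg μ c (fun u ↦ |u|) t := by
  calc |t| = |∫ x, (c x - (1 + c x) * t) ∂μ| := by
        rw [integral_sub_one_add_mul hc hmean, abs_neg]
    _ ≤ _ := abs_integral_le_integral_abs

lemma abs_add_le_stepAvg_abs (hc : Continuous c) (hlb : ∀ x, -1 ≤ c x)
    (hmean : ∫ x, c x ∂μ = 0) {t : ℝ} (ht₁ : -(11 / 10) ≤ t) (ht₂ : t ≤ -(8 / 10)) :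
    |t| + μ.real {x | c x < -(9 / 10)} ≤ stepAvg μ c (fun u ↦ |u|) t := by
  have hmeas : MeasurableSet {x | c x < -(9 / 10)} :=
    (isOpen_lt hc continuous_const).measurableSet
  have hint {f : X → ℝ} (hf : Continuous f) : Integrable f μ := integrable_of_continuous hf
  have hind : Integrable ({x | c x < -(9 / 10)}.indicator (1 : X → ℝ)) μ :=
    (integrable_const (1 : ℝ)).indicator hmeas
  calc |t| + μ.real {x | c x < -(9 / 10)}
      = ∫ x, ((c x - (1 + c x) * t) + {x | c x < -(9 / 10)}.indicator 1 x) ∂μ := by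
        rw [integral_add (hint (by fun_prop)) hind, integral_sub_one_add_mul hc hmean,
          integral_indicator_one hmeas, abs_of_nonpos (by linarith)]
    _ ≤ _ := by
        refine integral_mono ((hint (by fun_prop)).add hind) (hint (by fun_prop)) fun x ↦ ?_
        by_cases hx : c x < -(9 / 10)
        · simp only [Set.indicator, Set.mem_ofPred_eq, hx, if_true, Pi.one_apply]
          have h : c x - (1 + c x) * t ≤ -(1 / 2) := by nlinarith [hlb x]
          rw [abs_of_nonpos (by linarith)]
          linarith
        · simp only [Set.indicator, Set.mem_ofPred_eq, hx, if_false, add_zero]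
          exact le_abs_self _

lemma abs_add_le_stepAvg_stepAvg_abs (hc : Continuous c) (hlb : ∀ x, -1 ≤ c x)
    (hmean : ∫ x, c x ∂μ = 0) {B t : ℝ} (hB : 0 ≤ B) (ht : |t| ≤ B) :
    |t| + μ.real {x | c x < -(9 / 10)} * μ.real {x | c x < -1 + 1 / (10 * (B + 1))} ≤
      stepAvg μ c (stepAvg μ c fun u ↦ |u|) t := by
  set η := 1 / (10 * (B + 1)) with hη
  set A := {x | c x < -1 + η}
  set κ := μ.real {x | c x < -(9 / 10)}
  have hηB : η * B ≤ 1 / 10 := by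
    rw [hη, div_mul_eq_mul_div, div_le_iff₀ (by positivity)]
    linarith
  have hη₁ : η ≤ 1 / 10 := by
    rw [hη, div_le_iff₀ (by positivity)]
    linarith
  have hη₀ : 0 < η := by positivity
  have hmeas : MeasurableSet A := (isOpen_lt hc continuous_const).measurableSet
  have hint {f : X → ℝ} (hf : Continuous f) : Integrable f μ := integrable_of_continuous hf
  have hind : Integrable (A.indicator fun _ ↦ κ) μ := (integrable_const κ).indicator hmeas
  have hstep : Continuous (stepAvg μ c fun u ↦ |u|) := continuous_stepAvg hc continuous_abs
  calc |t| + κ * μ.real A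
      ≤ stepAvg μ c (fun u ↦ |u|) t + κ * μ.real A := by
        gcongr
        exact abs_le_stepAvg_abs hc hmean t
    _ = ∫ x, (|c x - (1 + c x) * t| + A.indicator (fun _ ↦ κ) x) ∂μ := by
        rw [integral_add (hint (by fun_prop)) hind, integral_indicator_const _ hmeas, stepAvg,
          smul_eq_mul, mul_comm κ]
    _ ≤ _ := by
        refine integral_mono ((hint (by fun_prop)).add hind) (hint (by fun_prop)) fun x ↦ ?_
        by_cases hx : x ∈ A
        · simp only [Set.indicator_of_mem hx]
          have hx' : c x < -1 + η := hx
          have h : |(1 + c x) * t| ≤ 1 / 10 := by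
            rw [abs_mul, abs_of_nonneg (by linarith [hlb x])]
            refine le_trans ?_ hηB
            gcongr
            linarith
          have := abs_le.1 h
          exact abs_add_le_stepAvg_abs hc hlb hmean (by linarith [hlb x]) (by linarith)
        · simp only [Set.indicator_of_notMem hx, add_zero]
          exact abs_le_stepAvg_abs hc hmean _

/-- Linear lower bound for the mean of the alternating Riesz sum of independent variables. -/
theorem exists_mul_le_integral_abs_altRieszSum [μ.IsOpenPosMeasure] (hc : Continuous c)
    (hlb : ∀ x, -1 ≤ c x) (hub : ∀ x, c x ≤ 1) (hmean : ∫ x, c x ∂μ = 0)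
    (hvar : ∫ x, c x ^ 2 ∂μ = 1 / 2) (hmin : ∃ x, c x = -1) :
    ∃ C : ℝ, 0 < C ∧ ∀ n : ℕ,
      C * n ≤ ∫ y, |altRieszSum n (c ∘ y)| ∂(Measure.pi fun _ ↦ μ) := by
  have hpos {a : ℝ} (ha : -1 < a) : 0 < μ.real {x | c x < a} := by
    obtain ⟨x, hx⟩ := hmin
    refine ENNReal.toReal_pos ?_ (measure_ne_top _ _)
    exact ((isOpen_lt hc continuous_const).measure_pos μ ⟨x, by simpa [hx] using ha⟩).ne'
  set δ := μ.real {x | c x < -(9 / 10)} * μ.real {x | c x < -1 + 1 / (10 * ((2304 : ℝ) + 1))}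
    with hδ
  have hδ₀ : 0 < δ := mul_pos (hpos (by norm_num)) (hpos (by norm_num))
  have hstep : Continuous (stepAvg μ c fun u ↦ |u|) := continuous_stepAvg hc continuous_abs
  have hstep₂ : Continuous (stepAvg μ c (stepAvg μ c fun u ↦ |u|)) := continuous_stepAvg hc hstep
  have htwo (t : ℝ) : |t| + δ * (1 - √|t| / 48) ≤ stepAvg μ c (stepAvg μ c fun u ↦ |u|) t := by
    rcases le_or_gt |t| 2304 with ht | ht
    · refine le_trans ?_ (abs_add_le_stepAvg_stepAvg_abs hc hlb hmean (by norm_num) ht)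
      have : 0 ≤ √|t| := Real.sqrt_nonneg _
      nlinarith
    · have h₁ : (48 : ℝ) ≤ √|t| := Real.le_sqrt_of_sq_le (by norm_num; exact ht.le)
      have h₂ : |t| ≤ stepAvg μ c (stepAvg μ c fun u ↦ |u|) t :=
        (abs_le_stepAvg_abs hc hmean t).trans <|
          integral_mono (integrable_of_continuous (by fun_prop))
            (integrable_of_continuous (by fun_prop)) fun x ↦ abs_le_stepAvg_abs hc hmean _
      nlinarith
  have hrec (n : ℕ) : ∫ y, |altRieszSum n (c ∘ y)| ∂(Measure.pi fun _ ↦ μ) + δ / 2 ≤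
      ∫ y, |altRieszSum (n + 2) (c ∘ y)| ∂(Measure.pi fun _ ↦ μ) := by
    have hcont := continuous_altRieszSum n
    rw [integral_altRieszSum_succ hc (φ := fun u ↦ |u|) continuous_abs,
      integral_altRieszSum_succ hc hstep]
    calc _ ≤ ∫ y, |altRieszSum n (c ∘ y)| ∂(Measure.pi fun _ ↦ μ) +
          δ * (1 - (∫ y, √|altRieszSum n (c ∘ y)| ∂(Measure.pi fun _ ↦ μ)) / 48) := by
          have := integral_sqrt_abs_altRieszSum_le hc hlb hub hmean hvar n
          nlinarith
      _ = ∫ y, (|altRieszSum n (c ∘ y)| + δ * (1 - √|altRieszSum n (c ∘ y)| / 48))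
          ∂(Measure.pi fun _ ↦ μ) := by
          rw [integral_add (integrable_of_continuous (by fun_prop))
            (integrable_of_continuous (by fun_prop)), integral_const_mul,
            integral_sub (integrable_of_continuous (by fun_prop))
            (integrable_of_continuous (by fun_prop)), integral_div]
          simp
      _ ≤ _ := integral_mono (integrable_of_continuous (by fun_prop))
            (integrable_of_continuous (by fun_prop)) fun y ↦ htwo _
  have hone : 1 / 2 ≤ ∫ y, |altRieszSum 1 (c ∘ y)| ∂(Measure.pi fun _ ↦ μ) := by
    rw [integral_altRieszSum_succ hc (φ := fun u ↦ |u|) continuous_abs]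
    simp only [altRieszSum_zero, stepAvg, mul_zero, sub_zero, integral_const, probReal_univ,
      one_smul, ← hvar]
    refine integral_mono (integrable_of_continuous (by fun_prop))
      (integrable_of_continuous (by fun_prop)) fun x ↦ ?_
    simp only [← sq_abs (c x)]
    nlinarith [abs_nonneg (c x), abs_le.2 ⟨hlb x, hub x⟩]
  refine ⟨min (1 / 2) (δ / 4), by positivity, fun n ↦ ?_⟩
  have hC₁ := min_le_left (1 / 2) (δ / 4)
  have hC₂ := min_le_right (1 / 2) (δ / 4)
  induction n using Nat.twoStepInduction with
  | zero => simp [altRieszSum_zero]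
  | one =>
    rw [Nat.cast_one, mul_one]
    exact hC₁.trans hone
  | more n ih _ =>
    push_cast
    linarith [hrec n]

end RandomRecursion

section Transfer

lemma intNorm_eq_norm {d : ℕ} (n : Fin d → ℤ) :
    intNorm n = ‖WithLp.toLp 2 (fun i ↦ (n i : ℝ))‖ := by
  simp [intNorm, EuclideanSpace.norm_eq]

lemma intNorm_pos {d : ℕ} {n : Fin d → ℤ} (hn : n ≠ 0) : 0 < intNorm n := by
  rw [intNorm_eq_norm, norm_pos_iff]
  contrapose! hn
  ext i
  simpa using congrArg (fun w : EuclideanSpace ℝ (Fin d) ↦ w i) hn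

/-- Consecutive terms of `v` grow in norm by a factor larger than `M`. -/
def IsLacunary {d s : ℕ} (M : ℝ) (v : Fin s → Fin d → ℤ) : Prop :=
  (∀ k, v k ≠ 0) ∧ ∀ k l : Fin s, (l : ℕ) = k + 1 → M * intNorm (v k) < intNorm (v l)

lemma IsLacunary.mono {d s : ℕ} {M M' : ℝ} {v : Fin s → Fin d → ℤ} (hv : IsLacunary M' v)
    (hM : M ≤ M') : IsLacunary M v :=
  ⟨hv.1, fun k l hkl ↦ (mul_le_mul_of_nonneg_right hM (intNorm_pos (hv.1 k)).le).trans_lt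
    (hv.2 k l hkl)⟩

lemma IsLacunary.mul_intNorm_lt {d s : ℕ} {M : ℝ} {v : Fin s → Fin d → ℤ} (hv : IsLacunary M v)
    (hM : 1 ≤ M) {k l : Fin s} (hkl : k < l) : M * intNorm (v k) < intNorm (v l) := by
  obtain ⟨l, hl⟩ := l
  induction l with
  | zero => exact absurd (Fin.lt_def.1 hkl) (Nat.not_lt_zero _)
  | succ l ih =>
    have hstep := hv.2 ⟨l, by omega⟩ ⟨l + 1, hl⟩ rfl
    rcases (Nat.lt_succ_iff.1 hkl).lt_or_eq with h | h
    · refine (ih (by omega) h).trans (lt_of_le_of_lt ?_ hstep)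
      exact le_mul_of_one_le_left (intNorm_pos (hv.1 _)).le hM
    · exact hv.2 k ⟨l + 1, hl⟩ (by simp [h])

/-- A sufficiently lacunary sequence satisfies no prescribed nontrivial integer relation. -/
lemma IsLacunary.sum_ne_zero {d s : ℕ} {v : Fin s → Fin d → ℤ} {n : Fin s → ℤ} (hn : n ≠ 0)
    (hv : IsLacunary (1 + ∑ k, |(n k : ℝ)|) v) : ∑ k, n k • v k ≠ 0 := by
  set M := 1 + ∑ k, |(n k : ℝ)| with hMdef
  have hM : 1 ≤ M := le_add_of_nonneg_right (Finset.sum_nonneg fun _ _ ↦ abs_nonneg _)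
  have hne : (Finset.univ.filter fun k ↦ n k ≠ 0).Nonempty := by
    obtain ⟨k, hk⟩ := Function.ne_iff.1 hn
    exact ⟨k, by simpa using hk⟩
  obtain ⟨m, hm, hmax⟩ := Finset.exists_max_image _ id hne
  simp only [Finset.mem_filter, Finset.mem_univ, true_and, id] at hm hmax
  intro h0
  let w (k : Fin s) : EuclideanSpace ℝ (Fin d) := WithLp.toLp 2 fun i ↦ (v k i : ℝ)
  have hw (k : Fin s) : ‖w k‖ = intNorm (v k) := (intNorm_eq_norm _).symm
  have hsum : ∑ k, (n k : ℝ) • w k = 0 := by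
    ext i
    have := congr_fun h0 i
    simp only [Finset.sum_apply, Pi.smul_apply, smul_eq_mul, Pi.zero_apply] at this
    simp only [WithLp.ofLp_sum, WithLp.ofLp_smul, Finset.sum_apply, Pi.smul_apply, smul_eq_mul,
      WithLp.ofLp_zero, Pi.zero_apply, w]
    exact_mod_cast this
  have hterm (k : Fin s) (hk : k ∈ Finset.univ.erase m) :
      M * ‖(n k : ℝ) • w k‖ ≤ |(n k : ℝ)| * ‖w m‖ := by
    rw [norm_smul, Real.norm_eq_abs]
    by_cases hk0 : n k = 0
    · simp [hk0]
    · have hlt : k < m := lt_of_le_of_ne (hmax k hk0) (Finset.ne_of_mem_erase hk)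
      have := (hv.mul_intNorm_lt hM hlt).le
      rw [← hw, ← hw] at this
      nlinarith [abs_nonneg (n k : ℝ)]
  have hm1 : (1 : ℝ) ≤ |(n m : ℝ)| := by exact_mod_cast Int.one_le_abs hm
  have hwm : 0 < ‖w m‖ := by rw [hw]; exact intNorm_pos (hv.1 m)
  rw [← Finset.add_sum_erase _ _ (Finset.mem_univ m)] at hsum
  have hle : M * ‖w m‖ ≤ (∑ k, |(n k : ℝ)|) * ‖w m‖ := by
    calc M * ‖w m‖ ≤ M * ‖(n m : ℝ) • w m‖ := by
          rw [norm_smul, Real.norm_eq_abs]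
          gcongr
          exact le_mul_of_one_le_left hwm.le hm1
      _ = M * ‖∑ k ∈ Finset.univ.erase m, (n k : ℝ) • w k‖ := by
          rw [eq_neg_of_add_eq_zero_left hsum, norm_neg]
      _ ≤ ∑ k ∈ Finset.univ.erase m, M * ‖(n k : ℝ) • w k‖ := by
          rw [← Finset.mul_sum]
          gcongr
          exact norm_sum_le _ _
      _ ≤ ∑ k ∈ Finset.univ.erase m, |(n k : ℝ)| * ‖w m‖ := Finset.sum_le_sum hterm
      _ ≤ _ := by
          rw [← Finset.sum_mul]
          gcongr
          exact Finset.erase_subset _ _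
  nlinarith

/-- The map `ξ ↦ (⟨v k, ξ⟩ mod 1)ₖ` from `ℝ^d` to the torus. -/
noncomputable def phases {d s : ℕ} (v : Fin s → Fin d → ℤ) (ξ : Fin d → ℝ) :
    UnitAddTorus (Fin s) :=
  fun k ↦ ((∑ i, (v k i : ℝ) * ξ i : ℝ) : UnitAddCircle)

lemma continuous_phases {d s : ℕ} (v : Fin s → Fin d → ℤ) : Continuous (phases v) := by
  unfold phases
  refine continuous_pi fun k ↦ (AddCircle.continuous_mk' 1).comp ?_
  fun_prop

lemma integral_Icc_exp {n : ℤ} (hn : n ≠ 0) :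
    ∫ x : ℝ in Set.Icc 0 1, Complex.exp (2 * π * Complex.I * n * x) = 0 := by
  have hc : 2 * π * Complex.I * n ≠ 0 := by simp [hn, Real.pi_ne_zero]
  rw [integral_Icc_eq_integral_Ioc, ← intervalIntegral.integral_of_le zero_le_one,
    integral_exp_mul_complex hc]
  have : Complex.exp (2 * π * Complex.I * n) = 1 := by
    rw [mul_comm]
    exact Complex.exp_int_mul_two_pi_mul_I n
  simp [this]

lemma integral_cube_exp {d : ℕ} {n : Fin d → ℤ} (hn : n ≠ 0) :
    ∫ ξ in Set.Icc (0 : Fin d → ℝ) 1,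
      Complex.exp (2 * π * Complex.I * ∑ i, (n i : ℂ) * ξ i) = 0 := by
  obtain ⟨i, hi⟩ := Function.ne_iff.1 hn
  rw [← Set.pi_univ_Icc, volume_pi, Measure.restrict_pi_pi]
  have h (ξ : Fin d → ℝ) : Complex.exp (2 * π * Complex.I * ∑ i, (n i : ℂ) * ξ i) =
      ∏ i, Complex.exp (2 * π * Complex.I * n i * ξ i) := by
    rw [← Complex.exp_sum, Finset.mul_sum]
    simp only [mul_assoc]
  simp only [h, Pi.zero_apply, Pi.one_apply]
  rw [integral_fintype_prod_eq_prod fun i (x : ℝ) ↦ Complex.exp (2 * π * Complex.I * n i * x)]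
  exact Finset.prod_eq_zero (Finset.mem_univ i) (integral_Icc_exp hi)

lemma mFourier_phases {d s : ℕ} (v : Fin s → Fin d → ℤ) (n : Fin s → ℤ) (ξ : Fin d → ℝ) :
    UnitAddTorus.mFourier n (phases v ξ) =
      Complex.exp (2 * π * Complex.I * ∑ i, (((∑ k, n k • v k) i : ℤ) : ℂ) * ξ i) := by
  simp only [UnitAddTorus.mFourier, phases, ContinuousMap.coe_mk, fourier_coe_apply]
  rw [← Complex.exp_sum]
  congr 1
  simp only [Finset.sum_apply, Pi.smul_apply, smul_eq_mul, Int.cast_sum, Int.cast_mul,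
    Finset.sum_mul, Complex.ofReal_one, div_one, Complex.ofReal_sum, Complex.ofReal_mul,
    Complex.ofReal_intCast, Finset.mul_sum]
  rw [Finset.sum_comm]
  refine Finset.sum_congr rfl fun i _ ↦ Finset.sum_congr rfl fun k _ ↦ ?_
  ring

lemma integral_fourier_haarAddCircle {n : ℤ} (hn : n ≠ 0) :
    ∫ x : UnitAddCircle, fourier n x ∂AddCircle.haarAddCircle = 0 :=
  integral_eq_zero_of_add_right_eq_neg (fourier_add_half_inv_index hn one_pos)

lemma integral_mFourier_haar {s : ℕ} {n : Fin s → ℤ} (hn : n ≠ 0) :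
    ∫ y, UnitAddTorus.mFourier n y ∂(Measure.pi fun _ ↦ AddCircle.haarAddCircle) = 0 := by
  obtain ⟨k, hk⟩ := Function.ne_iff.1 hn
  simp only [UnitAddTorus.mFourier, ContinuousMap.coe_mk]
  rw [integral_fintype_prod_eq_prod fun k (x : UnitAddCircle) ↦ (fourier (n k) x : ℂ)]
  exact Finset.prod_eq_zero (Finset.mem_univ k) (integral_fourier_haarAddCircle hk)

lemma integrable_phases {d s : ℕ} {E : Type*} [NormedAddCommGroup E]
    (v : Fin s → Fin d → ℤ) {F : UnitAddTorus (Fin s) → E} (hF : Continuous F) :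
    Integrable (fun ξ ↦ F (phases v ξ)) (volume.restrict (Set.Icc (0 : Fin d → ℝ) 1)) :=
  (hF.comp (continuous_phases v)).continuousOn.integrableOn_compact isCompact_Icc

lemma volume_real_cube (d : ℕ) : volume.real (Set.Icc (0 : Fin d → ℝ) 1) = 1 := by
  simp [Measure.real, Real.volume_Icc_pi]

/-- For a trigonometric polynomial, sufficiently lacunary phases are exactly independent. -/
lemma exists_integral_phases_eq {d s : ℕ} {P : C(UnitAddTorus (Fin s), ℂ)}
    (hP : P ∈ Submodule.span ℂ (Set.range UnitAddTorus.mFourier)) :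
    ∃ M : ℝ, 0 < M ∧ ∀ v : Fin s → Fin d → ℤ, IsLacunary M v →
      ∫ ξ in Set.Icc (0 : Fin d → ℝ) 1, P (phases v ξ) =
        ∫ y, P y ∂(Measure.pi fun _ ↦ AddCircle.haarAddCircle) := by
  induction hP using Submodule.span_induction with
  | mem P hP =>
    obtain ⟨n, rfl⟩ := hP
    by_cases hn : n = 0
    · refine ⟨1, one_pos, fun v _ ↦ ?_⟩
      simp [hn, UnitAddTorus.mFourier_zero, volume_real_cube]
    · refine ⟨1 + ∑ k, |(n k : ℝ)|, by positivity, fun v hv ↦ ?_⟩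
      simp only [mFourier_phases]
      rw [integral_cube_exp (hv.sum_ne_zero hn), integral_mFourier_haar hn]
  | zero => exact ⟨1, one_pos, fun v _ ↦ by simp⟩
  | add P Q _ _ hP hQ =>
    obtain ⟨M, hM, hP⟩ := hP
    obtain ⟨N, -, hQ⟩ := hQ
    refine ⟨max M N, lt_max_of_lt_left hM, fun v hv ↦ ?_⟩
    simp only [ContinuousMap.add_apply]
    rw [integral_add (integrable_phases v P.continuous) (integrable_phases v Q.continuous),
      integral_add (integrable_of_continuous P.continuous)
        (integrable_of_continuous Q.continuous),
      hP v (hv.mono (le_max_left _ _)), hQ v (hv.mono (le_max_right _ _))]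
  | smul a P _ hP =>
    obtain ⟨M, hM, hP⟩ := hP
    refine ⟨M, hM, fun v hv ↦ ?_⟩
    simp only [ContinuousMap.smul_apply]
    rw [integral_smul, integral_smul, hP v hv]

/-- For a continuous function, sufficiently lacunary phases are nearly independent. -/
theorem exists_integral_sub_le_integral_phases {d s : ℕ} {F : UnitAddTorus (Fin s) → ℝ}
    (hF : Continuous F) {ε : ℝ} (hε : 0 < ε) :
    ∃ M : ℝ, 0 < M ∧ ∀ v : Fin s → Fin d → ℤ, IsLacunary M v →
      ∫ y, F y ∂(Measure.pi fun _ ↦ AddCircle.haarAddCircle) - ε ≤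
        ∫ ξ in Set.Icc (0 : Fin d → ℝ) 1, F (phases v ξ) := by
  let G : C(UnitAddTorus (Fin s), ℂ) := ⟨fun y ↦ (F y : ℂ), by fun_prop⟩
  have hG : G ∈ (Submodule.span ℂ
      (Set.range (UnitAddTorus.mFourier (d := Fin s)))).topologicalClosure := by
    rw [UnitAddTorus.span_mFourier_closure_eq_top]
    trivial
  obtain ⟨P, hP, hGP⟩ := Metric.mem_closure_iff.1 hG (ε / 2) (half_pos hε)
  obtain ⟨M, hM, hMP⟩ := exists_integral_phases_eq (d := d) hP
  refine ⟨M, hM, fun v hv ↦ ?_⟩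
  have hpt (y : UnitAddTorus (Fin s)) : ‖G y - P y‖ ≤ ε / 2 := by
    rw [← dist_eq_norm]
    exact (ContinuousMap.dist_apply_le_dist y).trans hGP.le
  have h₁ := norm_integral_le_of_norm_le_const (μ := Measure.pi fun _ : Fin s ↦
    AddCircle.haarAddCircle) (ae_of_all _ hpt)
  have : IsFiniteMeasure (volume.restrict (Set.Icc (0 : Fin d → ℝ) 1)) :=
    isFiniteMeasure_restrict.2 isCompact_Icc.measure_lt_top.ne
  have h₂ := norm_integral_le_of_norm_le_const (μ := volume.restrict (Set.Icc (0 : Fin d → ℝ) 1))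
    (ae_of_all _ fun ξ ↦ hpt (phases v ξ))
  rw [integral_sub (integrable_of_continuous G.continuous)
    (integrable_of_continuous P.continuous)] at h₁
  rw [integral_sub (integrable_phases v G.continuous) (integrable_phases v P.continuous),
    hMP v hv] at h₂
  have hG₁ : ∫ y, G y ∂(Measure.pi fun _ ↦ AddCircle.haarAddCircle) =
      ((∫ y, F y ∂(Measure.pi fun _ ↦ AddCircle.haarAddCircle) : ℝ) : ℂ) := integral_ofReal
  have hG₂ : ∫ ξ in Set.Icc (0 : Fin d → ℝ) 1, G (phases v ξ) =
      ((∫ ξ in Set.Icc (0 : Fin d → ℝ) 1, F (phases v ξ) : ℝ) : ℂ) := integral_ofReal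
  simp only [measureReal_restrict_apply_univ, volume_real_cube, probReal_univ, mul_one] at h₁ h₂
  have h := (norm_sub_le_norm_sub_add_norm_sub _ _ _).trans
    (add_le_add h₁ ((norm_sub_rev _ _).trans_le h₂))
  rw [hG₁, hG₂, ← Complex.ofReal_sub, Complex.norm_real, Real.norm_eq_abs, add_halves] at h
  linarith [(abs_le.1 h).2]

end Transfer

section Cosine

/-- The function `cos (2π x)` on the circle `ℝ / ℤ`. -/
noncomputable def circleCos (x : UnitAddCircle) : ℝ := (fourier 1 x : ℂ).re

lemma continuous_circleCos : Continuous circleCos :=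
  Complex.continuous_re.comp (fourier 1).continuous

lemma circleCos_coe (x : ℝ) : circleCos x = Real.cos (2 * π * x) := by
  rw [circleCos, fourier_coe_apply, ← Complex.exp_ofReal_mul_I_re]
  congr 2
  push_cast
  ring

lemma integral_circleCos : ∫ x, circleCos x ∂AddCircle.haarAddCircle = 0 := by
  have h : ∫ x, circleCos x ∂AddCircle.haarAddCircle =
      (∫ x : UnitAddCircle, fourier 1 x ∂AddCircle.haarAddCircle).re :=
    integral_re (integrable_of_continuous (fourier 1).continuous)
  rw [h, integral_fourier_haarAddCircle one_ne_zero, Complex.zero_re]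

lemma integral_circleCos_sq : ∫ x, circleCos x ^ 2 ∂AddCircle.haarAddCircle = 1 / 2 := by
  have hsq (x : UnitAddCircle) : circleCos x ^ 2 = 1 / 2 + (fourier 2 x : ℂ).re / 2 := by
    induction x using QuotientAddGroup.induction_on with | _ x
    have h₂ : (fourier 2 (x : UnitAddCircle) : ℂ).re = Real.cos (2 * (2 * π * x)) := by
      rw [fourier_coe_apply, ← Complex.exp_ofReal_mul_I_re]
      congr 2
      push_cast
      ring
    refine (congrArg (· ^ 2) (circleCos_coe x)).trans ?_
    refine Eq.trans ?_ (congrArg (1 / 2 + · / 2) h₂.symm)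
    simp only [Real.cos_sq]
  have h : ∫ x : UnitAddCircle, (fourier 2 x : ℂ).re ∂AddCircle.haarAddCircle =
      (∫ x : UnitAddCircle, fourier 2 x ∂AddCircle.haarAddCircle).re :=
    integral_re (integrable_of_continuous (fourier 2).continuous)
  simp only [hsq]
  rw [integral_add (integrable_const _) (integrable_of_continuous (by fun_prop)), integral_div,
    integral_div, h,
    integral_fourier_haarAddCircle two_ne_zero]
  simp

lemma abs_circleCos_le (x : UnitAddCircle) : |circleCos x| ≤ 1 := by
  refine (Complex.abs_re_le_norm _).trans ?_
  rw [fourier_apply, Circle.norm_coe]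

end Cosine

/-- There is a constant `C > 0` such that for each `s` there is a lacunarity threshold `M(s)`
so that for every lacunary sequence `d^1,…,d^s` in `ℤ^d \ {0}` the alternating-sign
Riesz-product sum has `L¹([0,1]^d)` norm at least `C·s`. -/
theorem riesz_product_lower_bound_alternating (d : ℕ) :
    ∃ C : ℝ, 0 < C ∧ ∀ s : ℕ, 0 < s →
      ∃ M : ℝ, 0 < M ∧
        ∀ v : Fin s → (Fin d → ℤ), (∀ k, v k ≠ 0) →
          (∀ k l : Fin s, (l : ℕ) = (k : ℕ) + 1 → M * intNorm (v k) < intNorm (v l)) →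
          C * s ≤ ∫ ξ in Set.Icc (0 : Fin d → ℝ) 1,
            |∑ j : Fin s, (-1 : ℝ) ^ (j : ℕ) *
                Real.cos (2 * Real.pi * ∑ i, (v j i : ℝ) * ξ i) *
              ∏ k ∈ Finset.Iio j,
                (1 + Real.cos (2 * Real.pi * ∑ i, (v k i : ℝ) * ξ i))| := by
  obtain ⟨C, hC, hlower⟩ := exists_mul_le_integral_abs_altRieszSum
    (μ := AddCircle.haarAddCircle (T := 1)) continuous_circleCos
    (fun x ↦ (abs_le.1 (abs_circleCos_le x)).1) (fun x ↦ (abs_le.1 (abs_circleCos_le x)).2)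
    integral_circleCos integral_circleCos_sq
    ⟨((1 / 2 : ℝ) : UnitAddCircle), by rw [circleCos_coe]; ring_nf; exact Real.cos_pi⟩
  refine ⟨C / 2, half_pos hC, fun s hs ↦ ?_⟩
  have hcont : Continuous fun y : UnitAddTorus (Fin s) ↦ |altRieszSum s (circleCos ∘ y)| :=
    ((continuous_altRieszSum s).comp (continuous_pi fun k ↦
      continuous_circleCos.comp (continuous_apply k))).abs
  have hs' : (0 : ℝ) < s := Nat.cast_pos.2 hs
  obtain ⟨M, hM, hMv⟩ := exists_integral_sub_le_integral_phases (d := d) hcont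
    (by positivity : 0 < C / 2 * s)
  refine ⟨M, hM, fun v hv hlac ↦ ?_⟩
  have h := hMv v ⟨hv, hlac⟩
  have hphase (ξ : Fin d → ℝ) (k : Fin s) :
      circleCos (phases v ξ k) = Real.cos (2 * Real.pi * ∑ i, (v k i : ℝ) * ξ i) :=
    circleCos_coe _
  simp only [altRieszSum, Function.comp_apply, hphase] at h
  have hl := hlower s
  simp only [altRieszSum, Function.comp_apply] at hl
  linarith
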